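/- arXiv:1912.11596 — 2 statements merged into one kernel-verified Lean document; each statement's English description precedes it below -/
import Mathlib

section
/- Fix an integer s ≥ 1, real coefficients α_0, …, α_s with α_0 = α_1 = 1, an integer k ≥ 1, and reals μ, ν with μ = 0 in case k = 1. Then there exists a constant C > 0, depending only on s, α_0, …, α_s, k, μ, ν, such that for every real Hilbert space V, every semi-negative continuous linear operator Z on V with ‖Z‖ ≤ λ for some λ ∈ (0, 1], every ε ∈ (0, 1), and every u0 ∈ V, the filtering step satisfies ‖u_F‖² − ‖u_+‖² ≥ (−μ − ε|μ|) [Z^{k−1} u0]² + (2ν − Cλ/ε) ‖Z^k u0‖², where u_+ := R(Z)u0 and u_F := (I + μ(Z†)^{k−1}Z^k + ν(Z†)^kZ^k) u_+. -/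
open RealInnerProductSpace ContinuousLinearMap

/-- The semi-inner-product `[v, w] := −⟨Zv, w⟩ − ⟨v, Zw⟩` associated with `Z`. -/
noncomputable def semiIP {V : Type*} [NormedAddCommGroup V] [InnerProductSpace ℝ V]
    (Z : V →L[ℝ] V) (v w : V) : ℝ :=
  -⟪Z v, w⟫ - ⟪v, Z w⟫

section SemiInnerProduct

variable {V : Type*} [NormedAddCommGroup V] [InnerProductSpace ℝ V]

lemma semiIP_self (Z : V →L[ℝ] V) (v : V) : semiIP Z v v = -2 * ⟪Z v, v⟫ := by
  rw [semiIP, real_inner_comm (Z v) v]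
  ring

lemma semiIP_self_le (Z : V →L[ℝ] V) {lam : ℝ} (hZ : ‖Z‖ ≤ lam) (v : V) :
    semiIP Z v v ≤ 2 * lam * ‖v‖ ^ 2 := by
  have h₁ := (abs_le.mp (abs_real_inner_le_norm (Z v) v)).1
  have h₂ : ‖Z v‖ * ‖v‖ ≤ lam * ‖v‖ * ‖v‖ := by
    gcongr
    exact Z.le_of_opNorm_le hZ v
  rw [semiIP_self]
  linarith

/-- Perturbation estimate for the seminorm, from the weighted Cauchy–Schwarz inequality. -/
lemma abs_semiIP_add_self_sub_le (Z : V →L[ℝ] V) (hneg : ∀ v : V, ⟪Z v, v⟫ ≤ 0)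
    {ε : ℝ} (hε : 0 < ε) (v d : V) :
    |semiIP Z (v + d) (v + d) - semiIP Z v v|
      ≤ ε * semiIP Z v v + (1 + 1 / ε) * semiIP Z d d := by
  have hd := hneg d
  have hp := hneg (ε • v + d)
  have hm := hneg (ε • v - d)
  simp only [semiIP_self, map_add, map_sub, map_smul, inner_add_left, inner_add_right,
    inner_sub_left, inner_sub_right, real_inner_smul_left, real_inner_smul_right] at hp hm ⊢
  set a := ⟪Z v, v⟫
  set b := ⟪Z v, d⟫
  set c := ⟪Z d, v⟫
  set e := ⟪Z d, d⟫
  have hp' : b + c ≤ -(ε * a) - 1 / ε * e := by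
    have : ε * (b + c) ≤ ε * (-(ε * a) - 1 / ε * e) := by
      field_simp
      linarith
    exact le_of_mul_le_mul_left this hε
  have hm' : -(b + c) ≤ -(ε * a) - 1 / ε * e := by
    have : ε * -(b + c) ≤ ε * (-(ε * a) - 1 / ε * e) := by
      field_simp
      linarith
    exact le_of_mul_le_mul_left this hε
  rw [abs_le]
  constructor <;> linarith

lemma abs_norm_add_sq_sub_norm_sq_le {y d : V} {c : ℝ} (hd : ‖d‖ ≤ c * ‖y‖) :
    |‖y + d‖ ^ 2 - ‖y‖ ^ 2| ≤ (2 * c + c ^ 2) * ‖y‖ ^ 2 := by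
  have hsq : ‖d‖ ^ 2 ≤ (c * ‖y‖) ^ 2 := by gcongr
  have hin : |⟪y, d⟫| ≤ ‖y‖ * (c * ‖y‖) :=
    (abs_real_inner_le_norm y d).trans (by gcongr)
  have := sq_nonneg ‖d‖
  rw [abs_le] at hin
  rw [norm_add_sq_real, abs_le]
  constructor <;> nlinarith

lemma norm_pow_apply_le_of_norm_le_one {Z : V →L[ℝ] V} (hZ : ‖Z‖ ≤ 1) (j : ℕ) (v : V) :
    ‖(Z ^ j) v‖ ≤ ‖v‖ := by
  induction j with
  | zero => simp
  | succ j ih =>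
    rw [pow_succ']
    exact ((Z.le_of_opNorm_le hZ _).trans_eq (one_mul _)).trans ih

lemma norm_sum_smul_pow_apply_le {Z : V →L[ℝ] V} (hZ : ‖Z‖ ≤ 1) (a : ℕ → ℝ) (n : ℕ) (v : V) :
    ‖(∑ j ∈ Finset.range n, a j • Z ^ j) v‖ ≤ (∑ j ∈ Finset.range n, |a j|) * ‖v‖ := by
  rw [sum_apply, Finset.sum_mul]
  refine norm_sum_le_of_le _ fun j _ => ?_
  rw [smul_apply, norm_smul, Real.norm_eq_abs]
  gcongr
  exact norm_pow_apply_le_of_norm_le_one hZ j v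

lemma sum_range_succ_smul_pow_apply (Z : V →L[ℝ] V) (a : ℕ → ℝ) (ha : a 0 = 1) (n : ℕ) (v : V) :
    (∑ j ∈ Finset.range (n + 1), a j • Z ^ j) v
      = v + (∑ j ∈ Finset.range n, a (j + 1) • Z ^ j) (Z v) := by
  rw [Finset.sum_range_succ']
  simp [ha, pow_succ, sum_apply, add_comm]

lemma pow_apply_sum_smul_pow_apply (Z : V →L[ℝ] V) (a : ℕ → ℝ) (n m : ℕ) (v : V) :
    (Z ^ m) ((∑ j ∈ Finset.range n, a j • Z ^ j) v)
      = (∑ j ∈ Finset.range n, a j • Z ^ j) ((Z ^ m) v) := by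
  have h : Commute (Z ^ m) (∑ j ∈ Finset.range n, a j • Z ^ j) :=
    Commute.sum_right _ _ _ fun j _ => ((Commute.refl Z).pow_pow m j).smul_right (a j)
  exact DFunLike.congr_fun h.eq v

lemma adjoint_pow [CompleteSpace V] (Z : V →L[ℝ] V) (n : ℕ) :
    adjoint Z ^ n = adjoint (Z ^ n) := by
  simp only [← star_eq_adjoint, star_pow]

/-- Dropping the square of the increment bounds the energy change of a filtering step from below. -/
lemma filtering_energy_ge [CompleteSpace V] (Z : V →L[ℝ] V) (μ ν : ℝ) (m : ℕ) (u : V) :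
    -μ * semiIP Z ((Z ^ m) u) ((Z ^ m) u) + 2 * ν * ‖(Z ^ (m + 1)) u‖ ^ 2
      ≤ ‖((1 : V →L[ℝ] V) + μ • (adjoint Z ^ m * Z ^ (m + 1))
          + ν • (adjoint Z ^ (m + 1) * Z ^ (m + 1))) u‖ ^ 2 - ‖u‖ ^ 2 := by
  have hZ : (Z ^ (m + 1)) u = Z ((Z ^ m) u) := by rw [pow_succ']; rfl
  simp only [adjoint_pow, add_apply, smul_apply, one_apply_eq_self, mul_apply_eq_comp, add_assoc]
  rw [norm_add_sq_real, inner_add_right, real_inner_smul_right, real_inner_smul_right,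
    adjoint_inner_right, adjoint_inner_right, real_inner_self_eq_norm_sq, semiIP_self, hZ,
    real_inner_comm]
  have := sq_nonneg ‖μ • adjoint (Z ^ m) (Z ((Z ^ m) u))
    + ν • adjoint (Z ^ (m + 1)) (Z ((Z ^ m) u))‖
  linarith

end SemiInnerProduct

/-- lower bound on the energy change of the filtering step. -/
theorem filtering_energy_lower_bound
    (s : ℕ) (hs : 1 ≤ s) (α : ℕ → ℝ) (hα0 : α 0 = 1) (hα1 : α 1 = 1)
    (k : ℕ) (hk : 1 ≤ k) (μ ν : ℝ) (hμ : k = 1 → μ = 0) :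
    ∃ C : ℝ, 0 < C ∧
      ∀ (V : Type*) [NormedAddCommGroup V] [InnerProductSpace ℝ V] [CompleteSpace V]
        (Z : V →L[ℝ] V), (∀ v : V, ⟪Z v, v⟫ ≤ 0) →
        ∀ lam : ℝ, 0 < lam → lam ≤ 1 → ‖Z‖ ≤ lam →
        ∀ ε : ℝ, 0 < ε → ε < 1 → ∀ u0 : V,
          ‖((1 : V →L[ℝ] V) + μ • (adjoint Z ^ (k - 1) * Z ^ k)
              + ν • (adjoint Z ^ k * Z ^ k))
            ((∑ j ∈ Finset.range (s + 1), α j • Z ^ j) u0)‖ ^ 2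
            - ‖(∑ j ∈ Finset.range (s + 1), α j • Z ^ j) u0‖ ^ 2
          ≥ (-μ - ε * |μ|) * semiIP Z ((Z ^ (k - 1)) u0) ((Z ^ (k - 1)) u0)
            + (2 * ν - C * lam / ε) * ‖(Z ^ k) u0‖ ^ 2 := by
  obtain ⟨m, rfl⟩ := Nat.exists_eq_add_of_le' hk
  set M := ∑ j ∈ Finset.range s, |α (j + 1)|
  have hM0 : 0 ≤ M := Finset.sum_nonneg fun _ _ => abs_nonneg _
  refine ⟨1 + 4 * |μ| * M ^ 2 + 2 * |ν| * (2 * M + M ^ 2), by positivity, ?_⟩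
  intro V _ _ _ Z hneg lam hlam hlam1 hZ ε hε hε1 u0
  have hZ1 := hZ.trans hlam1
  rw [Nat.add_sub_cancel]
  refine (filtering_energy_ge Z μ ν m _).trans' ?_
  simp only [pow_apply_sum_smul_pow_apply]
  simp only [sum_range_succ_smul_pow_apply Z α hα0]
  set Q := ∑ j ∈ Finset.range s, α (j + 1) • Z ^ j
  have hQ : ∀ x, ‖Q x‖ ≤ M * ‖x‖ := norm_sum_smul_pow_apply_le hZ1 (fun j => α (j + 1)) s
  have hy : Z ((Z ^ m) u0) = (Z ^ (m + 1)) u0 := by rw [pow_succ']; rfl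
  rw [hy]
  set v := (Z ^ m) u0
  set y := (Z ^ (m + 1)) u0
  have hε' : 1 ≤ 1 / ε := (one_le_div hε).mpr hε1.le
  have hsemi : |semiIP Z (v + Q y) (v + Q y) - semiIP Z v v|
      ≤ ε * semiIP Z v v + 4 * M ^ 2 * (lam / ε) * ‖y‖ ^ 2 := by
    have hd : semiIP Z (Q y) (Q y) ≤ 2 * lam * (M * ‖y‖) ^ 2 :=
      (semiIP_self_le Z hZ _).trans (by gcongr; exact hQ y)
    have hd0 : 0 ≤ semiIP Z (Q y) (Q y) := by
      rw [semiIP_self]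
      linarith [hneg (Q y)]
    calc _ ≤ _ := abs_semiIP_add_self_sub_le Z hneg hε v (Q y)
      _ ≤ ε * semiIP Z v v + (1 / ε + 1 / ε) * (2 * lam * (M * ‖y‖) ^ 2) := by gcongr
      _ = _ := by ring
  have hnorm : |‖y + Q (Z y)‖ ^ 2 - ‖y‖ ^ 2| ≤ (2 * M + M ^ 2) * (lam / ε) * ‖y‖ ^ 2 := by
    have hd : ‖Q (Z y)‖ ≤ M * lam * ‖y‖ := by
      rw [mul_assoc]
      exact (hQ _).trans (by gcongr; exact Z.le_of_opNorm_le hZ y)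
    refine (abs_norm_add_sq_sub_norm_sq_le hd).trans ?_
    gcongr
    calc 2 * (M * lam) + (M * lam) ^ 2 = (2 * M + M ^ 2 * lam) * lam := by ring
      _ ≤ (2 * M + M ^ 2 * 1) * (lam / ε) := by
        gcongr
        exact le_div_self hlam.le hε hε1.le
      _ = _ := by ring
  have h₁ := (le_abs_self _).trans ((abs_mul μ _).trans_le
    (mul_le_mul_of_nonneg_left hsemi (abs_nonneg μ)))
  have h₂ := (neg_abs_le _).trans' (neg_le_neg ((abs_mul ν _).trans_le
    (mul_le_mul_of_nonneg_left hnorm (abs_nonneg ν))))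
  have h₃ : 0 ≤ lam / ε * ‖y‖ ^ 2 := by positivity
  rw [mul_div_assoc]
  linarith
end

section
/- Fix a real Hilbert space V, an integer s ≥ 1 and real coefficients α_0, …, α_s. Assume the energy identity: there are an integer k* with 1 ≤ k* ≤ s, reals β_{k*}, …, β_s, and symmetric reals (γ_{i,j})_{0≤i,j≤s−1} such that for every semi-negative continuous linear operator Z on V and every u0 ∈ V, ‖R(Z)u0‖² − ‖u0‖² = Σ_{k=k*}^s β_k ‖Z^k u0‖² + Σ_{i,j=0}^{s−1} γ_{i,j} [Z^i u0, Z^j u0]. Suppose e_0, …, e_{k*−1} are reals such that the k*×k* symmetric matrix Γ* − diag(e_0, …, e_{k*−1}) is negative definite, where Γ* := (γ_{i,j})_{0≤i,j≤k*−1}. Then for every δ > 0 there exists λ > 0 such that for every semi-negative continuous linear operator Z on V with ‖Z‖ ≤ λ and every u0 ∈ V, ‖R(Z)u0‖² − ‖u0‖² ≤ (β_{k*} + δ) ‖Z^{k*} u0‖² + Σ_{k=0}^{k*−1} e_k [Z^k u0]². -/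
open RealInnerProductSpace

open scoped MatrixOrder in
theorem Matrix.PosDef.exists_pos_posSemidef_sub_smul_one {n : Type*} [Fintype n] [DecidableEq n]
    {M : Matrix n n ℝ} (hM : M.PosDef) :
    ∃ ε : ℝ, 0 < ε ∧ (M - ε • (1 : Matrix n n ℝ)).PosSemidef := by
  cases isEmpty_or_nonempty n
  · exact ⟨1, one_pos, by rw [Subsingleton.elim (M - _) 0]; exact .zero⟩
  obtain ⟨ε, hε, h⟩ := (CFC.exists_pos_algebraMap_le_iff (A := Matrix n n ℝ) hM.1).2
    (fun x hx ↦ hM.isStrictlyPositive.spectrum_pos hx)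
  exact ⟨ε, hε, by simpa [Matrix.le_iff, Algebra.algebraMap_eq_smul_one] using h⟩

open scoped MatrixOrder Matrix.Norms.L2Operator in
theorem Matrix.PosSemidef.sum_mul_bilinForm_nonneg {n V : Type*} [Fintype n] [DecidableEq n]
    [AddCommGroup V] [Module ℝ V] {M : Matrix n n ℝ} (hM : M.PosSemidef)
    (S : LinearMap.BilinForm ℝ V) (hS : ∀ v, 0 ≤ S v v) (v : n → V) :
    0 ≤ ∑ i, ∑ j, M i j * S (v i) (v j) := by
  obtain ⟨B, rfl⟩ := CStarAlgebra.nonneg_iff_eq_star_mul_self.1 hM.nonneg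
  have key : ∑ i, ∑ j, (star B * B) i j * S (v i) (v j)
      = ∑ k, S (∑ i, B k i • v i) (∑ i, B k i • v i) := by
    simp only [map_sum, LinearMap.sum_apply, map_smul, LinearMap.smul_apply, smul_eq_mul,
      Matrix.mul_apply, Matrix.star_apply, star_trivial, Finset.sum_mul]
    simp_rw [Finset.mul_sum]
    rw [Finset.sum_comm_cycle]
    refine Finset.sum_congr rfl fun k _ ↦ ?_
    rw [Finset.sum_comm]
    exact Finset.sum_congr rfl fun i _ ↦ Finset.sum_congr rfl fun j _ ↦ by ring
  rw [key]
  exact Finset.sum_nonneg fun k _ ↦ hS _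

theorem Finset.sum_range_ite_lt_eq_sum_fin {M : Type*} [AddCommMonoid M] {k s : ℕ} (hks : k ≤ s)
    (f : ℕ → M) : ∑ i ∈ Finset.range s, (if i < k then f i else 0) = ∑ i : Fin k, f i := by
  rw [← Finset.sum_range (fun i ↦ f i), ← Finset.sum_filter]
  congr 1
  ext i
  simp only [Finset.mem_filter, Finset.mem_range]
  lia

section SemiIP

variable {V : Type*} [NormedAddCommGroup V] [InnerProductSpace ℝ V]

/-- The semi-inner-product `semiIP Z` as a bilinear form. -/
noncomputable def semiIPForm (Z : V →L[ℝ] V) : LinearMap.BilinForm ℝ V :=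
  LinearMap.mk₂ ℝ (semiIP Z)
    (fun _ _ _ ↦ by simp only [semiIP, map_add, inner_add_left]; ring)
    (fun _ _ _ ↦ by simp only [semiIP, map_smul, inner_smul_left, smul_eq_mul]; simp; ring)
    (fun _ _ _ ↦ by simp only [semiIP, map_add, inner_add_right]; ring)
    (fun _ _ _ ↦ by simp only [semiIP, map_smul, inner_smul_right, smul_eq_mul]; ring)

@[simp]
theorem semiIPForm_apply (Z : V →L[ℝ] V) (v w : V) : semiIPForm Z v w = semiIP Z v w := rfl

theorem semiIP_comm (Z : V →L[ℝ] V) (v w : V) : semiIP Z v w = semiIP Z w v := by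
  simp only [semiIP, real_inner_comm]
  ring

theorem semiIP_self_nonneg {Z : V →L[ℝ] V} (hZ : ∀ v, ⟪Z v, v⟫ ≤ 0) (v : V) :
    0 ≤ semiIP Z v v := by
  have h := hZ v
  have h' := real_inner_comm v (Z v)
  simp only [semiIP]
  linarith

theorem abs_semiIP_le (Z : V →L[ℝ] V) (v w : V) : |semiIP Z v w| ≤ 2 * ‖Z‖ * (‖v‖ * ‖w‖) := by
  have h₁ : |⟪Z v, w⟫| ≤ ‖Z‖ * ‖v‖ * ‖w‖ :=
    (abs_real_inner_le_norm _ _).trans (by gcongr; exact Z.le_opNorm v)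
  have h₂ : |⟪v, Z w⟫| ≤ ‖v‖ * (‖Z‖ * ‖w‖) :=
    (abs_real_inner_le_norm _ _).trans (by gcongr; exact Z.le_opNorm w)
  rw [abs_le] at *
  simp only [semiIP]
  constructor <;> nlinarith

/-- A weighted Young inequality for the semi-inner-product. -/
theorem mul_semiIP_le {Z : V →L[ℝ] V} (hZ : ∀ v, ⟪Z v, v⟫ ≤ 0) {η : ℝ} (hη : 0 < η) (c : ℝ)
    (v w : V) : c * semiIP Z v w ≤ η * semiIP Z v v + c ^ 2 / η * semiIP Z w w := by
  have hw := semiIP_self_nonneg hZ w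
  have hv := semiIP_self_nonneg hZ v
  have h := semiIP_self_nonneg hZ (v - (c / η) • w)
  have expand : semiIP Z (v - (c / η) • w) (v - (c / η) • w)
      = semiIP Z v v - 2 * (c / η) * semiIP Z v w + (c / η) ^ 2 * semiIP Z w w := by
    rw [← semiIPForm_apply]
    simp only [map_sub, map_smul, LinearMap.sub_apply, LinearMap.smul_apply, semiIPForm_apply,
      smul_eq_mul, semiIP_comm Z w v]
    ring
  rw [expand] at h
  have h' := mul_nonneg hη.le h
  have e : η * (semiIP Z v v - 2 * (c / η) * semiIP Z v w + (c / η) ^ 2 * semiIP Z w w)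
      = η * semiIP Z v v - 2 * (c * semiIP Z v w) + c ^ 2 / η * semiIP Z w w := by
    field_simp
  rw [e] at h'
  have h₁ := mul_nonneg hη.le hv
  have h₂ : 0 ≤ c ^ 2 / η * semiIP Z w w := by positivity
  linarith

theorem norm_pow_apply_le_of_le {Z : V →L[ℝ] V} (hZ : ‖Z‖ ≤ 1) {j k : ℕ} (h : k ≤ j) (u : V) :
    ‖(Z ^ j) u‖ ≤ ‖(Z ^ k) u‖ := by
  induction j, h using Nat.le_induction with
  | base => rfl
  | succ j _ ih =>
    rw [pow_succ', mul_apply_eq_comp]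
    exact (Z.le_of_opNorm_le hZ _).trans (by simpa using ih)

theorem norm_pow_apply_sq_le_of_lt {Z : V →L[ℝ] V} (hZ : ‖Z‖ ≤ 1) {j k : ℕ} (h : k < j) (u : V) :
    ‖(Z ^ j) u‖ ^ 2 ≤ ‖Z‖ * ‖(Z ^ k) u‖ ^ 2 := by
  obtain ⟨j, rfl⟩ : ∃ i, j = i + 1 := ⟨j - 1, by lia⟩
  rw [pow_succ' Z, mul_apply_eq_comp]
  have h₁ := Z.le_opNorm ((Z ^ j) u)
  have h₂ := norm_pow_apply_le_of_le hZ (Nat.lt_succ_iff.1 h) u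
  calc ‖Z ((Z ^ j) u)‖ ^ 2 ≤ (‖Z‖ * ‖(Z ^ k) u‖) ^ 2 := by
        gcongr
        exact h₁.trans (by gcongr)
    _ = ‖Z‖ * (‖Z‖ * ‖(Z ^ k) u‖ ^ 2) := by ring
    _ ≤ ‖Z‖ * (1 * ‖(Z ^ k) u‖ ^ 2) := by gcongr
    _ = _ := by ring

/-- Apart from the terms with both indices below `k`, each term of the quadratic form in the energy
identity is absorbed by small multiples of `[Zⁱu]²`, `i < k`, and of `‖Zᵏu‖²`. -/
theorem mul_semiIP_pow_le {Z : V →L[ℝ] V} (hZ : ∀ v, ⟪Z v, v⟫ ≤ 0) (hZ1 : ‖Z‖ ≤ 1) {η : ℝ}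
    (hη : 0 < η) (c : ℝ) (k i j : ℕ) (u : V) :
    c * semiIP Z ((Z ^ i) u) ((Z ^ j) u)
      ≤ (if i < k then if j < k then c * semiIP Z ((Z ^ i) u) ((Z ^ j) u) else 0 else 0)
        + η * (if i < k then semiIP Z ((Z ^ i) u) ((Z ^ i) u) else 0)
        + η * (if j < k then semiIP Z ((Z ^ j) u) ((Z ^ j) u) else 0)
        + 2 * (c ^ 2 / η + |c|) * (‖Z‖ * ‖(Z ^ k) u‖ ^ 2) := by
  have hnn (a : ℕ) := mul_nonneg hη.le (semiIP_self_nonneg hZ ((Z ^ a) u))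
  have hP : 0 ≤ ‖Z‖ * ‖(Z ^ k) u‖ ^ 2 := by positivity
  have hA : 0 ≤ c ^ 2 / η := by positivity
  have hB : 0 ≤ |c| := abs_nonneg c
  have hAP := mul_nonneg hA hP
  have hBP := mul_nonneg hB hP
  have hhigh (a b : ℕ) (ha : k ≤ a) (hb : k ≤ b) :
      |semiIP Z ((Z ^ a) u) ((Z ^ b) u)| ≤ 2 * (‖Z‖ * ‖(Z ^ k) u‖ ^ 2) := by
    refine (abs_semiIP_le Z _ _).trans ?_
    rw [pow_two, mul_assoc]
    gcongr <;> exact norm_pow_apply_le_of_le hZ1 ‹_› u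
  have hq (a : ℕ) (ha : k ≤ a) := mul_le_mul_of_nonneg_left
    ((le_abs_self _).trans (hhigh a a ha ha)) hA
  split_ifs with hi hj hj
  · linarith [hnn i, hnn j]
  · linarith [mul_semiIP_le hZ hη c ((Z ^ i) u) ((Z ^ j) u), hq j (not_lt.1 hj)]
  · rw [semiIP_comm]
    linarith [mul_semiIP_le hZ hη c ((Z ^ j) u) ((Z ^ i) u), hq i (not_lt.1 hi)]
  · have h := le_abs_self (c * semiIP Z ((Z ^ i) u) ((Z ^ j) u))
    rw [abs_mul] at h
    linarith [mul_le_mul_of_nonneg_left (hhigh i j (not_lt.1 hi) (not_lt.1 hj)) hB]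

theorem sum_mul_norm_pow_sq_le {Z : V →L[ℝ] V} (hZ : ‖Z‖ ≤ 1) {k s : ℕ} (hks : k ≤ s)
    (β : ℕ → ℝ) (u : V) :
    ∑ j ∈ Finset.Icc k s, β j * ‖(Z ^ j) u‖ ^ 2
      ≤ β k * ‖(Z ^ k) u‖ ^ 2 + (∑ j ∈ Finset.Ioc k s, |β j|) * (‖Z‖ * ‖(Z ^ k) u‖ ^ 2) := by
  rw [← Finset.Ioc_insert_left hks, Finset.sum_insert (by simp), Finset.sum_mul]
  gcongr with j hj
  · exact le_abs_self _
  · exact norm_pow_apply_sq_le_of_lt hZ (Finset.mem_Ioc.1 hj).1 u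

end SemiIP

/-- energy estimate from the energy identity, assuming
`Γ* − diag(e₀, …, e_{k*−1})` is negative definite. -/
theorem energy_estimate_of_energy_identity
    {V : Type*} [NormedAddCommGroup V] [InnerProductSpace ℝ V] [CompleteSpace V]
    (s : ℕ) (hs : 1 ≤ s) (α : ℕ → ℝ)
    (kst : ℕ) (hk1 : 1 ≤ kst) (hks : kst ≤ s)
    (β : ℕ → ℝ) (γ : ℕ → ℕ → ℝ) (hsym : ∀ i j, γ i j = γ j i)
    (hidentity : ∀ Z : V →L[ℝ] V, (∀ v : V, ⟪Z v, v⟫ ≤ 0) → ∀ u0 : V,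
      ‖(∑ j ∈ Finset.range (s + 1), α j • Z ^ j) u0‖ ^ 2 - ‖u0‖ ^ 2
        = ∑ k ∈ Finset.Icc kst s, β k * ‖(Z ^ k) u0‖ ^ 2
          + ∑ i ∈ Finset.range s, ∑ j ∈ Finset.range s,
              γ i j * semiIP Z ((Z ^ i) u0) ((Z ^ j) u0))
    (e : Fin kst → ℝ)
    (hmat : (-(Matrix.of (fun i j : Fin kst => γ i j) - Matrix.diagonal e)).PosDef) :
    ∀ δ : ℝ, 0 < δ → ∃ lam : ℝ, 0 < lam ∧
      ∀ Z : V →L[ℝ] V, (∀ v : V, ⟪Z v, v⟫ ≤ 0) → ‖Z‖ ≤ lam → ∀ u0 : V,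
        ‖(∑ j ∈ Finset.range (s + 1), α j • Z ^ j) u0‖ ^ 2 - ‖u0‖ ^ 2
          ≤ (β kst + δ) * ‖(Z ^ kst) u0‖ ^ 2
            + ∑ i : Fin kst, e i * semiIP Z ((Z ^ (i : ℕ)) u0) ((Z ^ (i : ℕ)) u0) := by
  intro δ hδ
  obtain ⟨ε, hε, hM⟩ := hmat.exists_pos_posSemidef_sub_smul_one
  have hs0 : (0 : ℝ) < s := by exact_mod_cast hs
  obtain ⟨η, hη, hηε⟩ : ∃ η : ℝ, 0 < η ∧ 2 * (s * η) = ε :=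
    ⟨ε / (2 * s), by positivity, by field_simp⟩
  set C : ℝ := ∑ k ∈ Finset.Ioc kst s, |β k|
    + ∑ i ∈ Finset.range s, ∑ j ∈ Finset.range s, 2 * (γ i j ^ 2 / η + |γ i j|) with hC
  have hC0 : 0 ≤ C := by positivity
  refine ⟨min 1 (δ / (C + 1)), by positivity, fun Z hZ hlam u ↦ ?_⟩
  have hZ1 : ‖Z‖ ≤ 1 := hlam.trans (min_le_left _ _)
  have hCZ : C * ‖Z‖ ≤ δ := by
    have h := (le_div_iff₀ (by positivity)).1 (hlam.trans (min_le_right _ _))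
    linarith [norm_nonneg Z]
  set N : ℝ := ‖(Z ^ kst) u‖ ^ 2
  have hCN : C * (‖Z‖ * N) ≤ δ * N := by
    rw [← mul_assoc]
    gcongr
  set S : ℕ → ℕ → ℝ := fun i j ↦ semiIP Z ((Z ^ i) u) ((Z ^ j) u) with hS
  have hcoercive : ∑ i : Fin kst, ∑ j : Fin kst, γ i j * S i j
      ≤ ∑ i : Fin kst, e i * S i i - ε * ∑ i : Fin kst, S i i := by
    have h := hM.sum_mul_bilinForm_nonneg (semiIPForm Z) (semiIP_self_nonneg hZ)
      (fun i : Fin kst ↦ (Z ^ (i : ℕ)) u)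
    simp only [Matrix.sub_apply, Matrix.smul_apply, Matrix.of_apply,
      semiIPForm_apply, Matrix.diagonal_apply, Matrix.one_apply, sub_mul, neg_sub,
      Finset.sum_sub_distrib, smul_eq_mul, mul_ite, mul_one, mul_zero, ite_mul, zero_mul,
      Finset.sum_ite_eq, Finset.mem_univ, if_true, ← Finset.mul_sum] at h
    linarith
  have hquad : ∑ i ∈ Finset.range s, ∑ j ∈ Finset.range s, γ i j * S i j
      ≤ ∑ i : Fin kst, ∑ j : Fin kst, γ i j * S i j + ε * ∑ i : Fin kst, S i i
        + (∑ i ∈ Finset.range s, ∑ j ∈ Finset.range s, 2 * (γ i j ^ 2 / η + |γ i j|))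
          * (‖Z‖ * N) := by
    refine (Finset.sum_le_sum fun i _ ↦ Finset.sum_le_sum fun j _ ↦
      mul_semiIP_pow_le hZ hZ1 hη (γ i j) kst i j u).trans_eq ?_
    have hblock : ∑ i ∈ Finset.range s, ∑ j ∈ Finset.range s,
        (if i < kst then if j < kst then γ i j * S i j else 0 else 0)
          = ∑ i : Fin kst, ∑ j : Fin kst, γ i j * S i j := by
      rw [← Finset.sum_range_ite_lt_eq_sum_fin hks fun i ↦ ∑ j : Fin kst, γ i j * S i j]
      refine Finset.sum_congr rfl fun i _ ↦ ?_
      split_ifs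
      · exact Finset.sum_range_ite_lt_eq_sum_fin hks fun j ↦ γ i j * S i j
      · exact Finset.sum_const_zero
    have hdiag := Finset.sum_range_ite_lt_eq_sum_fin hks fun i ↦ S i i
    simp only [hS] at hblock hdiag ⊢
    simp only [Finset.sum_add_distrib, ← Finset.mul_sum, ← Finset.sum_mul, hblock, hdiag,
      Finset.sum_const, Finset.card_range, nsmul_eq_mul, ← hηε]
    ring
  have hbeta := sum_mul_norm_pow_sq_le hZ1 hks β u
  rw [hidentity Z hZ u]
  simp only [hC, add_mul] at hCN
  rw [add_mul]
  linarith
end
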